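/- Let γ : ℝ → ℝ² be twice continuously differentiable with ‖γ′(s)‖ = 1 for all s, let ν(s) := (−γ₂′(s), γ₁′(s)), κ(s) := ⟨γ″(s), ν(s)⟩, n(s) := ν₁(s) + iν₂(s), and φ₁⁺(s,t) := ½cos(π(t+1)/4)·(1, −i n(s)) + ½sin(π(t+1)/4)·(1, i n(s)). Then for every s ∈ ℝ: ∫₋₁¹ ‖∂_sφ₁⁺(s,t)‖² dt = (κ(s)²/4)(2 − 4/π). -/

import Mathlib

noncomputable section

open Real Set

/-- The normal `ν(s) = (−γ₂′(s), γ₁′(s))` of a planar curve `γ`. -/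
def nuVec (γ : ℝ → ℝ × ℝ) (s : ℝ) : ℝ × ℝ := (-(deriv γ s).2, (deriv γ s).1)

/-- The curvature `κ(s) = ⟨γ″(s), ν(s)⟩` of a unit-speed planar curve `γ`. -/
def curv (γ : ℝ → ℝ × ℝ) (s : ℝ) : ℝ :=
  (deriv (deriv γ) s).1 * (nuVec γ s).1 + (deriv (deriv γ) s).2 * (nuVec γ s).2

/-- The complex normal `n(s) = ν₁(s) + i ν₂(s)`. -/
def nC (γ : ℝ → ℝ × ℝ) (s : ℝ) : ℂ :=
  ((nuVec γ s).1 : ℂ) + Complex.I * ((nuVec γ s).2 : ℂ)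

/-- `φ₁⁺(t) = ½cos(π(t+1)/4)·(1, −i n) + ½sin(π(t+1)/4)·(1, i n)`. -/
def phi1 (n : ℂ) (t : ℝ) : ℂ × ℂ :=
  ((Real.cos (π * (t + 1) / 4) : ℂ) / 2 + (Real.sin (π * (t + 1) / 4) : ℂ) / 2,
   (Real.cos (π * (t + 1) / 4) : ℂ) / 2 * (-(Complex.I * n)) +
     (Real.sin (π * (t + 1) / 4) : ℂ) / 2 * (Complex.I * n))

/-- Squared Euclidean (Hermitian) norm on `ℂ²`. -/
def normSq2 (u : ℂ × ℂ) : ℝ := Complex.normSq u.1 + Complex.normSq u.2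

/-- For a unit vector `(x, y)` orthogonal to `(a, b)`, the squared length of `(a, b)` is the square
of its component along `(-y, x)`. -/
theorem sq_add_sq_eq_sq_of_orthogonal {x y a b : ℝ} (hunit : x ^ 2 + y ^ 2 = 1)
    (horth : x * a + y * b = 0) : a ^ 2 + b ^ 2 = (a * -y + b * x) ^ 2 := by
  linear_combination (-(a ^ 2 + b ^ 2)) * hunit + (x * a + y * b) * horth

/-- The acceleration of a curve of constant unit speed is orthogonal to its velocity. -/
theorem velocity_orthogonal_acceleration {v : ℝ → ℝ × ℝ} {w : ℝ × ℝ} {s : ℝ}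
    (hv : HasDerivAt v w s) (hunit : ∀ s : ℝ, (v s).1 ^ 2 + (v s).2 ^ 2 = 1) :
    (v s).1 * w.1 + (v s).2 * w.2 = 0 := by
  have hfst : HasDerivAt (fun s => (v s).1) w.1 s := by simpa using HasFDerivAt.hasDerivAt hv.fst
  have hsnd : HasDerivAt (fun s => (v s).2) w.2 s := by simpa using HasFDerivAt.hasDerivAt hv.snd
  have h := (hfst.pow 2).add (hsnd.pow 2)
  have hc : HasDerivAt (fun s => (v s).1 ^ 2 + (v s).2 ^ 2) 0 s := by
    simpa only [hunit] using hasDerivAt_const s (1 : ℝ)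
  have := h.unique hc
  norm_num at this
  linarith

/-- The derivative of the complex normal. -/
theorem hasDerivAt_nC {γ : ℝ → ℝ × ℝ} {w : ℝ × ℝ} {s : ℝ} (h : HasDerivAt (deriv γ) w s) :
    HasDerivAt (nC γ) (((-w.2 : ℝ) : ℂ) + Complex.I * (w.1 : ℂ)) s := by
  have hfst : HasDerivAt (fun s => (deriv γ s).1) w.1 s := by simpa using HasFDerivAt.hasDerivAt h.fst
  have hsnd : HasDerivAt (fun s => (deriv γ s).2) w.2 s := by simpa using HasFDerivAt.hasDerivAt h.snd
  exact hsnd.neg.ofReal_comp.add (hfst.ofReal_comp.const_mul Complex.I)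

/-- The derivative of the transverse mode along a differentiable complex normal. -/
theorem hasDerivAt_phi1 {n : ℝ → ℂ} {n' : ℂ} {s : ℝ} (h : HasDerivAt n n' s) (t : ℝ) :
    HasDerivAt (fun s' => phi1 (n s') t)
      (0, (Real.cos (π * (t + 1) / 4) : ℂ) / 2 * (-(Complex.I * n')) +
        (Real.sin (π * (t + 1) / 4) : ℂ) / 2 * (Complex.I * n')) s :=
  (hasDerivAt_const s _).prodMk
    (((h.const_mul Complex.I).neg.const_mul _).add ((h.const_mul Complex.I).const_mul _))

/-- The squared norm of the derivative of the transverse mode. -/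
theorem normSq2_deriv_phi1 {n : ℝ → ℂ} {n' : ℂ} {s : ℝ} (h : HasDerivAt n n' s) (t : ℝ) :
    normSq2 (deriv (fun s' => phi1 (n s') t) s) =
      Complex.normSq n' / 4 * (1 - Real.sin (π * (t + 1) / 2)) := by
  rw [(hasDerivAt_phi1 h t).deriv]
  set θ := π * (t + 1) / 4 with hθ
  have hfactor : (Real.cos θ : ℂ) / 2 * (-(Complex.I * n')) +
      (Real.sin θ : ℂ) / 2 * (Complex.I * n') =
      (((Real.sin θ - Real.cos θ) / 2 : ℝ) : ℂ) * (Complex.I * n') := by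
    push_cast
    ring
  have hdouble : π * (t + 1) / 2 = 2 * θ := by rw [hθ]; ring
  rw [normSq2, hfactor, hdouble, Real.sin_two_mul]
  simp only [map_zero, map_mul, Complex.normSq_ofReal, Complex.normSq_I]
  linear_combination Complex.normSq n' / 4 * Real.sin_sq_add_cos_sq θ

theorem integral_one_sub_sin_pi_mul_add_one_div_two :
    ∫ t in (-1 : ℝ)..1, (1 - Real.sin (π * (t + 1) / 2)) = 2 - 4 / π := by
  have hderiv : ∀ t ∈ uIcc (-1 : ℝ) 1,
      HasDerivAt (fun t => t + 2 / π * Real.cos (π * (t + 1) / 2))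
        (1 - Real.sin (π * (t + 1) / 2)) t := by
    intro t _
    have hlin : HasDerivAt (fun t : ℝ => π * (t + 1) / 2) (π * 1 / 2) t :=
      (((hasDerivAt_id t).add_const 1).const_mul π).div_const 2
    refine ((hasDerivAt_id t).add (hlin.cos.const_mul (2 / π))).congr_deriv ?_
    field_simp
    ring
  rw [intervalIntegral.integral_eq_sub_of_hasDerivAt hderiv
    (Continuous.intervalIntegrable (by fun_prop) _ _)]
  have hone : π * (1 + 1) / 2 = π := by ring
  have hzero : π * (-1 + 1) / 2 = 0 := by ring
  rw [hone, hzero, Real.cos_pi, Real.cos_zero]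
  ring

theorem transverse_mode_s_derivative_norm
    (γ : ℝ → ℝ × ℝ) (hγ : ContDiff ℝ 2 γ)
    (hunit : ∀ s : ℝ, (deriv γ s).1 ^ 2 + (deriv γ s).2 ^ 2 = 1) :
    ∀ s : ℝ,
      ∫ t in (-1 : ℝ)..1, normSq2 (deriv (fun s' => phi1 (nC γ s') t) s) =
        (curv γ s) ^ 2 / 4 * (2 - 4 / π) := by
  intro s
  have hγ' : HasDerivAt (deriv γ) (deriv (deriv γ) s) s :=
    (hγ.differentiable_deriv_two s).hasDerivAt
  have hnorm : Complex.normSq (((-(deriv (deriv γ) s).2 : ℝ) : ℂ) +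
      Complex.I * ((deriv (deriv γ) s).1 : ℂ)) = curv γ s ^ 2 := by
    rw [mul_comm Complex.I, Complex.normSq_add_mul_I, curv, nuVec,
      ← sq_add_sq_eq_sq_of_orthogonal (hunit s) (velocity_orthogonal_acceleration hγ' hunit)]
    ring
  simp only [normSq2_deriv_phi1 (hasDerivAt_nC hγ'), hnorm]
  rw [intervalIntegral.integral_const_mul, integral_one_sub_sin_pi_mul_add_one_div_two]
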